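/- For n ≥ 7, there exists a commutator word w in the free group such that all nontrivial values of w in the alternating group A_n have order 3; consequently, the verbal subgroup w(A_n) need not be nilpotent even though all coprime-order pairs of w-values trivially satisfy the order-multiplicativity condition. -/

import Mathlib

/-- Finite intersections of normal subgroups with full image in a perfect group have full image. -/
lemma map_inf_eq_top {F G : Type*} [Group F] [Group G] (hG : ⁅(⊤ : Subgroup G), (⊤ : Subgroup G)⁆ = ⊤)
    (φ : F →* G) (M N : Subgroup F) [M.Normal] [N.Normal]
    (hM : M.map φ = ⊤) (hN : N.map φ = ⊤) : (M ⊓ N).map φ = ⊤ := by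
  rw [eq_top_iff]
  calc (⊤ : Subgroup G) = (⁅M, N⁆).map φ := by rw [Subgroup.map_commutator, hM, hN, hG]
    _ ≤ (M ⊓ N).map φ := Subgroup.map_mono (Subgroup.commutator_le_inf M N)

lemma exists_common {F G ι : Type*} [Group F] [Group G] (hG : ⁅(⊤ : Subgroup G), (⊤ : Subgroup G)⁆ = ⊤)
    (φ : F →* G) (hφ : Function.Surjective φ) (K : ι → Subgroup F) (hn : ∀ i, (K i).Normal)
    (hK : ∀ i, (K i).map φ = ⊤) (t : Finset ι) :
    ∃ N : Subgroup F, N.Normal ∧ N.map φ = ⊤ ∧ N ≤ commutator F ∧ ∀ i ∈ t, N ≤ K i := by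
  classical
  induction t using Finset.induction_on with
  | empty =>
    refine ⟨commutator F, inferInstance, ?_, le_rfl, by simp⟩
    rw [commutator_def, Subgroup.map_commutator, Subgroup.map_top_of_surjective φ hφ, hG]
  | insert a t _ ih =>
    obtain ⟨N, h1, h2, h3, h4⟩ := ih
    have := hn a
    refine ⟨K a ⊓ N, inferInstance, map_inf_eq_top hG φ _ _ (hK a) h2, inf_le_right.trans h3, ?_⟩
    intro i hi
    rcases Finset.mem_insert.1 hi with rfl | hi
    · exact inf_le_left
    · exact inf_le_right.trans (h4 i hi)

lemma ker_eq_of_le {F G : Type*} [Group F] [Group G] [Finite G] (φ ψ : F →* G)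
    (hφ : Function.Surjective φ) (h : ψ.ker ≤ φ.ker) : φ.ker = ψ.ker := by
  refine le_antisymm ?_ h
  rw [← Subgroup.relIndex_eq_one]
  have h1 := Subgroup.relIndex_mul_index h
  have h2 : φ.ker.index = Nat.card G := by
    rw [Subgroup.index_ker, MonoidHom.range_eq_top.2 hφ, Subgroup.card_top]
  have h3 : ψ.ker.index ≤ Nat.card G := by
    rw [Subgroup.index_ker]; exact Subgroup.card_le_card_group _
  have h4 : ψ.ker.index ≠ 0 := by
    rw [Subgroup.index_ker]; exact Nat.card_pos.ne'
  have h5 : 0 < Nat.card G := Nat.card_pos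
  rw [h2] at h1
  rw [← h1] at h3 h4
  have h6 : ψ.ker.relIndex φ.ker ≠ 0 := fun h => h4 (by rw [h, zero_mul])
  have h7 : ψ.ker.relIndex φ.ker ≤ 1 := by
    by_contra hc
    nlinarith
  omega

theorem kassabov_nikolov (n : ℕ) (hn : 7 ≤ n) :
    ∃ (s : ℕ) (w : FreeGroup (Fin s)),
      w ∈ commutator (FreeGroup (Fin s)) ∧
      (∀ f : Fin s → alternatingGroup (Fin n),
        FreeGroup.lift f w ≠ 1 → orderOf (FreeGroup.lift f w) = 3) ∧
      ¬ Group.IsNilpotent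
        (Subgroup.closure {g : alternatingGroup (Fin n) |
          ∃ f : Fin s → alternatingGroup (Fin n), g = FreeGroup.lift f w}) := by
  classical
  have h5 : 5 ≤ Nat.card (Fin n) := by simp; omega
  have hsimple : IsSimpleGroup (alternatingGroup (Fin n)) := alternatingGroup.isSimpleGroup h5
  have hperf : ⁅(⊤ : Subgroup (alternatingGroup (Fin n))), (⊤ : Subgroup _)⁆ = ⊤ :=
    commutator_alternatingGroup_eq_top h5
  obtain ⟨c, hc⟩ : ∃ c : alternatingGroup (Fin n), orderOf c = 3 := by
    have h3 := Equiv.Perm.isThreeCycle_swap_mul_swap_same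
      (a := (⟨0, by omega⟩ : Fin n)) (b := ⟨1, by omega⟩) (c := ⟨2, by omega⟩)
      (by simp) (by simp) (by simp)
    exact ⟨⟨_, h3.mem_alternatingGroup⟩, by rw [Subgroup.orderOf_mk]; exact h3.orderOf⟩
  generalize alternatingGroup (Fin n) = A at *
  obtain ⟨s, ⟨e⟩⟩ := Finite.exists_equiv_fin A
  have hφ : Function.Surjective (FreeGroup.lift (e.symm : Fin s → A)) := fun g =>
    ⟨FreeGroup.of (e g), by simp⟩
  set φ := FreeGroup.lift (e.symm : Fin s → A) with hφdef
  obtain ⟨N, -, hN, hNc, hNk⟩ := exists_common hperf φ hφ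
    (fun i : {f : Fin s → A // ¬ (FreeGroup.lift f).ker ≤ φ.ker} => (FreeGroup.lift i.1).ker)
    (fun i => inferInstance)
    (fun i => by
      have hnm : ((FreeGroup.lift i.1).ker.map φ).Normal :=
        Subgroup.Normal.map inferInstance φ hφ
      refine hnm.eq_bot_or_eq_top.resolve_left fun hb => i.2 ?_
      rwa [Subgroup.map_eq_bot_iff] at hb)
    Finset.univ
  obtain ⟨w, hw, hwc⟩ : c ∈ N.map φ := by rw [hN]; trivial
  refine ⟨s, w, hNc hw, ?_, ?_⟩
  · intro f hf
    by_cases hk : (FreeGroup.lift f).ker ≤ φ.ker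
    · rw [← hc, ← hwc, orderOf_eq_orderOf_iff]
      intro m
      have := ker_eq_of_le φ (FreeGroup.lift f) hφ hk
      rw [← map_pow, ← map_pow, ← MonoidHom.mem_ker, ← MonoidHom.mem_ker, this]
    · exact absurd (hNk ⟨f, hk⟩ (Finset.mem_univ _) hw) hf
  · have htop : Subgroup.closure {g : A | ∃ f : Fin s → A, g = FreeGroup.lift f w} = ⊤ := by
      have hle : Subgroup.normalClosure {g : A | ∃ f : Fin s → A, g = FreeGroup.lift f w} ≤
          Subgroup.closure {g : A | ∃ f : Fin s → A, g = FreeGroup.lift f w} := by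
        refine Subgroup.closure_mono fun x hx => ?_
        obtain ⟨a, ⟨f, rfl⟩, hax⟩ := Group.mem_conjugatesOfSet_iff.1 hx
        obtain ⟨b, rfl⟩ := isConj_iff.1 hax
        refine ⟨fun i => b * f i * b⁻¹, ?_⟩
        have : (MulAut.conj b).toMonoidHom.comp (FreeGroup.lift f) =
            FreeGroup.lift (fun i => b * f i * b⁻¹) := by
          ext i; simp
        rw [← this]; simp
      rw [eq_top_iff]
      refine le_trans (Eq.ge ?_) hle
      refine (Subgroup.normalClosure_normal.eq_bot_or_eq_top).resolve_left fun hb => ?_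
      have : c ∈ (⊥ : Subgroup A) := hb ▸ Subgroup.subset_normalClosure ⟨_, hwc.symm⟩
      rw [Subgroup.mem_bot.1 this] at hc
      simp at hc
    rw [htop]
    intro hnil
    have : Group.IsNilpotent A := Group.nilpotent_of_surjective
      (Subgroup.topEquiv : (⊤ : Subgroup A) ≃* A).toMonoidHom Subgroup.topEquiv.surjective
    have hp : Group.IsPerfect A := Group.isPerfect_def.2 hperf
    exact Group.IsPerfect.not_isSolvable A inferInstance
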